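/- Let α > 0 and θ ≥ 1. Let ψ : (0,∞) → [0,∞) be a non-negative, non-decreasing function such that t^{−α}ψ(t) ∈ 𝓛^θ. Then for any δ > 0 there exists a continuous and differentiable function φ on (0,∞) such that: (i) ψ(t) ≤ φ(t) for all t > 0; (ii) t ↦ φ(t)t^{−α−δ} is decreasing and t ↦ φ(t)t^{−α+δ} is increasing; (iii) ‖t^{−α}φ(t)‖_{𝓛^θ} ≤ c‖t^{−α}ψ(t)‖_{𝓛^θ}, where c is a constant depending only on δ and α. -/

import Mathlib

open MeasureTheory Set
open scoped ENNReal NNReal BigOperators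

noncomputable section

/-- The measure `du/u` on `(0,∞)`. -/
def muLog : Measure ℝ :=
  (volume.restrict (Set.Ioi (0:ℝ))).withDensity fun u => ENNReal.ofReal u⁻¹

/-- The `𝓛^θ` norm of an `ℝ≥0∞`-valued function on `(0,∞)` (with respect to `du/u`),
for `θ ∈ [1,∞]`; for `θ = ∞` it is the essential supremum. -/
def calLE (θ : ℝ≥0∞) (g : ℝ → ℝ≥0∞) : ℝ≥0∞ :=
  if θ = ∞ then essSup g muLog
  else (∫⁻ t, g t ^ θ.toReal ∂muLog) ^ (1 / θ.toReal)

/-- The `𝓛^θ` norm of a real-valued function on `(0,∞)`. -/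
def calL (θ : ℝ≥0∞) (g : ℝ → ℝ) : ℝ≥0∞ :=
  calLE θ fun t => ENNReal.ofReal |g t|

/-- The distribution function `λ_f(y) = |{x : |f x| > y}|`. -/
def distFn {n : ℕ} (f : (Fin n → ℝ) → ℝ) (y : ℝ) : ℝ≥0∞ :=
  volume {x | y < |f x|}

/-- `f ∈ S₀(ℝⁿ)`: measurable with finite distribution function for all `y > 0`. -/
def MemS0 {n : ℕ} (f : (Fin n → ℝ) → ℝ) : Prop :=
  Measurable f ∧ ∀ y : ℝ, 0 < y → distFn f y < ∞

/-- The non-increasing rearrangement `f*`. -/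
def rearr {n : ℕ} (f : (Fin n → ℝ) → ℝ) (t : ℝ) : ℝ :=
  sInf {y : ℝ | 0 ≤ y ∧ distFn f y ≤ ENNReal.ofReal t}

/-- The real-valued `L^p(ℝⁿ)` norm. -/
def lpR {n : ℕ} (p : ℝ) (f : (Fin n → ℝ) → ℝ) : ℝ :=
  (eLpNorm f (ENNReal.ofReal p) volume).toReal

/-- The difference of degree `k` in direction `j` with step `h`:
`Δ_j^k(h) f (x) = ∑ (-1)^{k-i} C(k,i) f(x + i h e_j)`. -/
def diffOp {n : ℕ} (j : Fin n) (k : ℕ) (h : ℝ) (f : (Fin n → ℝ) → ℝ) :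
    (Fin n → ℝ) → ℝ :=
  fun x => ∑ i ∈ Finset.range (k + 1),
    (-1 : ℝ) ^ (k - i) * (k.choose i : ℝ) * f (x + ((i : ℝ) * h) • (Pi.single j 1 : Fin n → ℝ))

/-- The modulus of continuity `ω_j^k(f;δ)_p = sup_{0<h≤δ} ‖Δ_j^k(h) f‖_p`. -/
def modCont {n : ℕ} (j : Fin n) (k : ℕ) (p : ℝ) (f : (Fin n → ℝ) → ℝ) (δ : ℝ) : ℝ :=
  sSup ((fun h => lpR p (diffOp j k h f)) '' Set.Ioc 0 δ)

/-- The directional Besov seminorm `‖f‖_{b^r_{p,θ;j}}` with difference order `k`. -/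
def besov {n : ℕ} (j : Fin n) (k : ℕ) (r p : ℝ) (θ : ℝ≥0∞)
    (f : (Fin n → ℝ) → ℝ) : ℝ≥0∞ :=
  calL θ fun h => h ^ (-r) * lpR p (diffOp j k h f)

/-- The Lorentz quasinorm `‖f‖_{q,s} = ‖t^{1/q} f*(t)‖_{𝓛^s}`. -/
def lorentz {n : ℕ} (q : ℝ) (s : ℝ≥0∞) (f : (Fin n → ℝ) → ℝ) : ℝ≥0∞ :=
  calL s fun t => t ^ (1 / q) * rearr f t

/-- The norm in the sum space `L¹ + L^{p₀}`. -/
def sumNormE {n : ℕ} (p₀ : ℝ) (f : (Fin n → ℝ) → ℝ) : ℝ≥0∞ :=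
  ⨅ (g : (Fin n → ℝ) → ℝ) (h : (Fin n → ℝ) → ℝ) (_ : f = g + h),
    eLpNorm g 1 volume + eLpNorm h (ENNReal.ofReal p₀) volume

/-- The function `σ(t) = inf { max_j t^{-1/p_j} φ_j(δ_j) : δ_j > 0, ∏ δ_j = t }`. -/
def sigmaFn {n : ℕ} (pp : Fin n → ℝ) (φ : Fin n → ℝ → ℝ) (t : ℝ) : ℝ :=
  sInf {a : ℝ | ∃ d : Fin n → ℝ, (∀ j, 0 < d j) ∧ (∏ j, d j) = t ∧
    a = ⨆ j, t ^ (-(pp j)⁻¹) * φ j (d j)}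

open Filter Topology

instance muLog_sfinite : SFinite muLog := by unfold muLog; infer_instance

lemma ae_muLog_of {P : ℝ → Prop} (h : ∀ t, 0 < t → P t) : ∀ᵐ t ∂muLog, P t := by
  unfold muLog
  apply (withDensity_absolutelyContinuous _ _).ae_le
  exact (ae_restrict_iff' measurableSet_Ioi).2 (Eventually.of_forall h)

lemma lint_muLog (g : ℝ → ℝ≥0∞) :
    ∫⁻ t, g t ∂muLog = ∫⁻ t in Ioi (0:ℝ), ENNReal.ofReal t⁻¹ * g t := by
  unfold muLog
  rw [lintegral_withDensity_eq_lintegral_mul_non_measurable _ (by fun_prop)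
    (Eventually.of_forall fun _ => ENNReal.ofReal_lt_top)]
  rfl

lemma holder_aux {μ : Measure ℝ} {f k : ℝ → ℝ≥0∞} (hf : AEMeasurable f μ)
    (hk : AEMeasurable k μ) {A : ℝ≥0∞} (hA : ∫⁻ s, k s ∂μ ≤ A) {p : ℝ} (hp : 1 ≤ p) :
    (∫⁻ s, f s * k s ∂μ) ^ p ≤ A ^ (p - 1) * ∫⁻ s, f s ^ p * k s ∂μ := by
  rcases hp.eq_or_lt with rfl | hp
  · simp
  have hc := Real.HolderConjugate.conjExponent hp
  set q := Real.conjExponent p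
  have hp0 : 0 < p := by linarith
  have hq0 : 0 < q := hc.symm.pos
  have h1 : ∫⁻ s, f s * k s ∂μ ≤
      (∫⁻ s, f s ^ p * k s ∂μ) ^ (1 / p) * (∫⁻ s, k s ∂μ) ^ (1 / q) := by
    have := ENNReal.lintegral_mul_le_Lp_mul_Lq μ hc
      (f := fun s => f s * k s ^ (1 / p)) (g := fun s => k s ^ (1 / q))
      (by fun_prop) (by fun_prop)
    convert this using 1
    · refine lintegral_congr fun s => ?_
      simp only [Pi.mul_apply]
      rw [mul_assoc, ← ENNReal.rpow_add_of_nonneg _ _ (by positivity) (by positivity)]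
      have : 1 / p + 1 / q = 1 := by simpa using hc.inv_add_inv_eq_one
      rw [this, ENNReal.rpow_one]
    · congr 2
      · refine lintegral_congr fun s => ?_
        rw [ENNReal.mul_rpow_of_nonneg _ _ hp0.le, ← ENNReal.rpow_mul]
        simp [hp0.ne']
      · refine lintegral_congr fun s => ?_
        rw [← ENNReal.rpow_mul]
        simp [hq0.ne']
  have h2 : 1 / q * p = p - 1 := by
    have := hc.inv_add_inv_eq_one
    have e : 1 / q = 1 - p⁻¹ := by rw [one_div]; linarith
    rw [e]; field_simp
  calc (∫⁻ s, f s * k s ∂μ) ^ p ≤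
      ((∫⁻ s, f s ^ p * k s ∂μ) ^ (1 / p) * (∫⁻ s, k s ∂μ) ^ (1 / q)) ^ p := by gcongr
    _ = (∫⁻ s, f s ^ p * k s ∂μ) * (∫⁻ s, k s ∂μ) ^ (p - 1) := by
      rw [ENNReal.mul_rpow_of_nonneg _ _ hp0.le, ← ENNReal.rpow_mul, ← ENNReal.rpow_mul, h2]
      simp [hp0.ne']
    _ ≤ _ := by
      rw [mul_comm]
      gcongr

lemma schur_aux {μ : Measure ℝ} [SFinite μ] {f : ℝ → ℝ≥0∞} (hf : AEMeasurable f μ)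
    {k : ℝ → ℝ → ℝ≥0∞} (hk : Measurable (Function.uncurry k)) {A : ℝ≥0∞}
    (h1 : ∀ᵐ t ∂μ, ∫⁻ s, k t s ∂μ ≤ A) (h2 : ∀ᵐ s ∂μ, ∫⁻ t, k t s ∂μ ≤ A)
    {p : ℝ} (hp : 1 ≤ p) :
    (∫⁻ t, (∫⁻ s, f s * k t s ∂μ) ^ p ∂μ) ^ (1 / p) ≤ A * (∫⁻ s, f s ^ p ∂μ) ^ (1 / p) := by
  have hp0 : 0 < p := by linarith
  have hk1 : ∀ t, Measurable (k t) := fun t => hk.comp measurable_prodMk_left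
  have hk2 : ∀ s, Measurable (fun t => k t s) := fun s => hk.comp measurable_prodMk_right
  have : (∫⁻ t, (∫⁻ s, f s * k t s ∂μ) ^ p ∂μ) ≤ A ^ p * (∫⁻ s, f s ^ p ∂μ) := by
    calc (∫⁻ t, (∫⁻ s, f s * k t s ∂μ) ^ p ∂μ)
        ≤ ∫⁻ t, A ^ (p - 1) * ∫⁻ s, f s ^ p * k t s ∂μ ∂μ := by
          apply lintegral_mono_ae
          filter_upwards [h1] with t ht
          exact holder_aux hf (hk1 t).aemeasurable ht hp
      _ = ∫⁻ t, ∫⁻ s, A ^ (p - 1) * (f s ^ p * k t s) ∂μ ∂μ := by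
          refine lintegral_congr fun t => ?_
          rw [lintegral_const_mul'']
          exact (hf.pow_const _).mul (hk1 t).aemeasurable
      _ = ∫⁻ s, ∫⁻ t, A ^ (p - 1) * (f s ^ p * k t s) ∂μ ∂μ := by
          apply lintegral_lintegral_swap
          have h3 : AEMeasurable (fun z : ℝ × ℝ => f z.2) (μ.prod μ) := hf.comp_snd
          exact ((h3.pow_const p).mul hk.aemeasurable).const_mul _
      _ = ∫⁻ s, (A ^ (p - 1) * f s ^ p) * ∫⁻ t, k t s ∂μ ∂μ := by
          refine lintegral_congr fun s => ?_
          rw [← lintegral_const_mul _ (hk2 s)]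
          simp only [mul_assoc]
      _ ≤ ∫⁻ s, A ^ p * f s ^ p ∂μ := by
          apply lintegral_mono_ae
          filter_upwards [h2] with s hs
          calc (A ^ (p - 1) * f s ^ p) * ∫⁻ t, k t s ∂μ ≤ (A ^ (p - 1) * f s ^ p) * A := by gcongr
            _ = (A ^ (p - 1) * A ^ (1:ℝ)) * f s ^ p := by rw [ENNReal.rpow_one]; ring
            _ = _ := by
              rw [← ENNReal.rpow_add_of_nonneg _ _ (by linarith) (by norm_num)]; simp
      _ = _ := by
          rw [lintegral_const_mul'' _ (hf.pow_const _)]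
  calc _ ≤ (A ^ p * (∫⁻ s, f s ^ p ∂μ)) ^ (1 / p) := by gcongr
    _ = _ := by
      rw [ENNReal.mul_rpow_of_nonneg _ _ (by positivity), ← ENNReal.rpow_mul]
      simp [hp0.ne']

lemma schur_calLE {f : ℝ → ℝ≥0∞} (hf : AEMeasurable f muLog)
    {k : ℝ → ℝ → ℝ≥0∞} (hk : Measurable (Function.uncurry k)) {A : ℝ≥0∞}
    (h1 : ∀ᵐ t ∂muLog, ∫⁻ s, k t s ∂muLog ≤ A) (h2 : ∀ᵐ s ∂muLog, ∫⁻ t, k t s ∂muLog ≤ A)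
    {θ : ℝ≥0∞} (hθ : 1 ≤ θ) :
    calLE θ (fun t => ∫⁻ s, f s * k t s ∂muLog) ≤ A * calLE θ f := by
  unfold calLE
  split_ifs with h
  · refine essSup_le_of_ae_le _ ?_
    have hk1 : ∀ t, Measurable (k t) := fun t => hk.comp measurable_prodMk_left
    filter_upwards [h1] with t ht
    calc ∫⁻ s, f s * k t s ∂muLog ≤ ∫⁻ s, essSup f muLog * k t s ∂muLog := by
          apply lintegral_mono_ae
          filter_upwards [ENNReal.ae_le_essSup f] with s hs
          gcongr
      _ = essSup f muLog * ∫⁻ s, k t s ∂muLog := lintegral_const_mul _ (hk1 t)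
      _ ≤ essSup f muLog * A := by gcongr
      _ = _ := mul_comm _ _
  · exact schur_aux hf hk h1 h2 (by simpa using ENNReal.toReal_mono h hθ)

def kerJ (δ q s : ℝ) : ℝ := s ^ (δ - 1) / (q + (s ^ δ) ^ 2)

lemma kerJ_main {δ : ℝ} (hδ : 0 < δ) {r : ℝ} (hr : 0 < r) :
    IntegrableOn (kerJ δ (r ^ 2)) (Ioi 0) ∧
      ∫ s in Ioi (0:ℝ), kerJ δ (r ^ 2) s = Real.pi / (2 * δ * r) := by
  set g : ℝ → ℝ := fun s => Real.arctan (s ^ δ / r) / (δ * r)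
  have hcont : ContinuousWithinAt g (Ici 0) 0 := by
    apply Continuous.continuousWithinAt
    have := Real.continuous_rpow_const hδ.le
    exact (Real.continuous_arctan.comp (this.div_const r)).div_const _
  have hderiv : ∀ x ∈ Ioi (0:ℝ), HasDerivAt g (kerJ δ (r ^ 2) x) x := by
    intro x hx
    have h1 : HasDerivAt (fun s : ℝ => s ^ δ / r) (δ * x ^ (δ - 1) / r) x :=
      (Real.hasDerivAt_rpow_const (Or.inl (ne_of_gt hx))).div_const r
    have := h1.arctan.div_const (δ * r)
    refine this.congr_deriv ?_
    unfold kerJ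
    have : 0 < r ^ 2 + (x ^ δ) ^ 2 := by positivity
    field_simp
  have hpos : ∀ x ∈ Ioi (0:ℝ), 0 ≤ kerJ δ (r ^ 2) x := by
    intro x hx
    have : (0:ℝ) < x := hx
    unfold kerJ; positivity
  have hlim : Tendsto g atTop (𝓝 (Real.pi / 2 / (δ * r))) := by
    apply Tendsto.div_const
    have := (Real.tendsto_arctan_atTop.mono_right nhdsWithin_le_nhds).comp
      ((tendsto_rpow_atTop hδ).atTop_div_const hr)
    exact this
  refine ⟨integrableOn_Ioi_deriv_of_nonneg hcont hderiv hpos hlim, ?_⟩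
  rw [integral_Ioi_of_hasDerivAt_of_nonneg hcont hderiv hpos hlim]
  simp only [g, Real.zero_rpow hδ.ne', zero_div, Real.arctan_zero, sub_zero]
  field_simp

/-- the kernel -/
def kerK (δ t s : ℝ) : ℝ := t ^ δ * s ^ δ / ((t ^ δ) ^ 2 + (s ^ δ) ^ 2)

lemma kerK_symm (δ t s : ℝ) : kerK δ t s = kerK δ s t := by
  unfold kerK; rw [mul_comm, add_comm]

lemma kerK_eq {δ t s : ℝ} (hs : 0 < s) : s⁻¹ * kerK δ t s = t ^ δ * kerJ δ ((t ^ δ) ^ 2) s := by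
  unfold kerK kerJ
  rw [Real.rpow_sub hs, Real.rpow_one]; field_simp

lemma kerK_int {δ : ℝ} (hδ : 0 < δ) {t : ℝ} (ht : 0 < t) :
    ∫⁻ s, ENNReal.ofReal (kerK δ t s) ∂muLog ≤ ENNReal.ofReal (Real.pi / (2 * δ)) := by
  have hr : 0 < t ^ δ := by positivity
  obtain ⟨h1, h2⟩ := kerJ_main hδ hr
  rw [lint_muLog]
  have : ∫⁻ s in Ioi (0:ℝ), ENNReal.ofReal s⁻¹ * ENNReal.ofReal (kerK δ t s) =
      ∫⁻ s in Ioi (0:ℝ), ENNReal.ofReal (t ^ δ * kerJ δ ((t ^ δ) ^ 2) s) := by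
    refine setLIntegral_congr_fun measurableSet_Ioi fun s hs => ?_
    have hs : (0:ℝ) < s := hs
    rw [← ENNReal.ofReal_mul (by positivity), kerK_eq hs]
  rw [this, ← ofReal_integral_eq_lintegral_ofReal (h1.const_mul _)]
  · rw [integral_const_mul, h2]
    apply ENNReal.ofReal_le_ofReal
    apply le_of_eq; field_simp
  · refine (ae_restrict_iff' measurableSet_Ioi).2 (Eventually.of_forall fun s hs => ?_)
    have hs : (0:ℝ) < s := hs
    simp only [Pi.zero_apply, kerJ]; positivity

lemma calLE_mono {θ : ℝ≥0∞} {f g : ℝ → ℝ≥0∞} (h : ∀ t, 0 < t → f t ≤ g t) :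
    calLE θ f ≤ calLE θ g := by
  have := ae_muLog_of h
  unfold calLE
  split_ifs
  · exact essSup_mono_ae this
  · gcongr ?_ ^ _
    apply lintegral_mono_ae
    filter_upwards [this] with t ht
    gcongr

lemma schur_final {δ : ℝ} (hδ : 0 < δ) {f : ℝ → ℝ≥0∞} (hf : AEMeasurable f muLog)
    {θ : ℝ≥0∞} (hθ : 1 ≤ θ) :
    calLE θ (fun t => ∫⁻ s, f s * ENNReal.ofReal (kerK δ t s) ∂muLog) ≤
      ENNReal.ofReal (Real.pi / (2 * δ)) * calLE θ f := by
  apply schur_calLE hf _ _ _ hθ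
  · unfold kerK Function.uncurry
    fun_prop
  · exact ae_muLog_of fun t ht => kerK_int hδ ht
  · refine ae_muLog_of fun t ht => ?_
    simp_rw [fun s => kerK_symm δ s t]
    exact kerK_int hδ ht

lemma mu_lower {t : ℝ} (ht : 0 < t) : ENNReal.ofReal (1/2) ≤ muLog (Icc t (2*t)) := by
  have hsub : Icc t (2*t) ⊆ Ioi 0 := fun x hx => lt_of_lt_of_le ht hx.1
  have h1 : muLog (Icc t (2*t)) = ∫⁻ s in Icc t (2*t), ENNReal.ofReal s⁻¹ := by
    unfold muLog
    rw [withDensity_apply _ measurableSet_Icc, Measure.restrict_restrict measurableSet_Icc,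
      inter_eq_left.2 hsub]
  rw [h1]
  calc ENNReal.ofReal (1/2) = ENNReal.ofReal (2*t)⁻¹ * volume (Icc t (2*t)) := by
        rw [Real.volume_Icc, ← ENNReal.ofReal_mul (by positivity)]
        congr 1; field_simp; ring
    _ = ∫⁻ s in Icc t (2*t), ENNReal.ofReal (2*t)⁻¹ := by simp
    _ ≤ _ := by
      apply setLIntegral_mono' measurableSet_Icc
      intro s hs
      apply ENNReal.ofReal_le_ofReal
      have := hs.2
      have : 0 < s := lt_of_lt_of_le ht hs.1
      gcongr

lemma bdd_F {α : ℝ} (hα : 0 < α) {θ : ℝ≥0∞} (hθ : 1 ≤ θ) {ψ : ℝ → ℝ}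
    (h0 : ∀ t, 0 < t → 0 ≤ ψ t) (hm : MonotoneOn ψ (Ioi 0))
    (hfin : calL θ (fun t => t ^ (-α) * ψ t) < ∞) :
    ∃ M : ℝ, ∀ t, 0 < t → t ^ (-α) * ψ t ≤ M := by
  have key : ∀ t, 0 < t → ∀ s ∈ Icc t (2*t),
      ENNReal.ofReal (2 ^ (-α) * (t ^ (-α) * ψ t)) ≤ ENNReal.ofReal |s ^ (-α) * ψ s| := by
    intro t ht s hs
    have hs0 : 0 < s := lt_of_lt_of_le ht hs.1
    apply ENNReal.ofReal_le_ofReal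
    refine le_trans ?_ (le_abs_self _)
    rw [← mul_assoc, ← Real.mul_rpow (by norm_num) ht.le]
    have h1 := h0 t ht
    have h2 := hm ht hs0 hs.1
    have h3 : (2*t) ^ (-α) ≤ s ^ (-α) :=
      Real.rpow_le_rpow_of_nonpos hs0 hs.2 (by linarith)
    gcongr
  suffices h : ∃ B : ℝ≥0∞, B < ∞ ∧ ∀ t, 0 < t → ENNReal.ofReal (2 ^ (-α) * (t ^ (-α) * ψ t)) ≤ B by
    obtain ⟨B, hB, h⟩ := h
    refine ⟨2 ^ α * B.toReal, fun t ht => ?_⟩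
    have := (ENNReal.ofReal_le_iff_le_toReal hB.ne).1 (h t ht)
    calc t ^ (-α) * ψ t = 2 ^ α * (2 ^ (-α) * (t ^ (-α) * ψ t)) := by
          rw [← mul_assoc, ← Real.rpow_add (by norm_num)]; simp
      _ ≤ _ := by gcongr
  unfold calL calLE at hfin
  split_ifs at hfin with h
  · refine ⟨_, hfin, fun t ht => ?_⟩
    by_contra hlt
    push Not at hlt
    have hz : muLog (Icc t (2*t)) = 0 := by
      refine measure_mono_null ?_ (ae_iff.1 (ENNReal.ae_le_essSup
        (fun t => ENNReal.ofReal |t ^ (-α) * ψ t|) (μ := muLog)))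
      intro s hs
      exact not_le.2 (lt_of_lt_of_le hlt (key t ht s hs))
    have := mu_lower ht
    rw [hz] at this
    norm_num at this
  · set p := θ.toReal
    have hp : 1 ≤ p := by simpa using ENNReal.toReal_mono h hθ
    have hp0 : 0 < p := by linarith
    set I := ∫⁻ t, ENNReal.ofReal |t ^ (-α) * ψ t| ^ p ∂muLog
    have hI : I < ∞ := by
      by_contra hc
      have : I = ∞ := by simpa using hc
      rw [this, ENNReal.top_rpow_of_pos (by positivity)] at hfin
      exact lt_irrefl _ hfin
    refine ⟨(I / ENNReal.ofReal (1/2)) ^ (1/p : ℝ), ?_, fun t ht => ?_⟩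
    · apply ENNReal.rpow_lt_top_of_nonneg (by positivity)
      apply (ENNReal.div_lt_top hI.ne _).ne
      simp
    · rw [one_div p, ENNReal.le_rpow_inv_iff hp0, ENNReal.le_div_iff_mul_le (by simp) (by simp)]
      calc ENNReal.ofReal (2 ^ (-α) * (t ^ (-α) * ψ t)) ^ p * ENNReal.ofReal (1/2)
          ≤ ENNReal.ofReal (2 ^ (-α) * (t ^ (-α) * ψ t)) ^ p * muLog (Icc t (2*t)) := by
            gcongr; exact mu_lower ht
        _ = ∫⁻ s in Icc t (2*t), ENNReal.ofReal (2 ^ (-α) * (t ^ (-α) * ψ t)) ^ p ∂muLog := by simp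
        _ ≤ ∫⁻ s in Icc t (2*t), ENNReal.ofReal |s ^ (-α) * ψ s| ^ p ∂muLog := by
            apply setLIntegral_mono' measurableSet_Icc
            intro s hs
            exact ENNReal.rpow_le_rpow (key t ht s hs) hp0.le
        _ ≤ I := setLIntegral_le_lintegral _ _

lemma G_int {δ : ℝ} (hδ : 0 < δ) {F : ℝ → ℝ} {M : ℝ}
    (hFm : AEMeasurable F (volume.restrict (Ioi 0)))
    (hF0 : ∀ t, 0 < t → 0 ≤ F t) (hFM : ∀ t, 0 < t → F t ≤ M) {q : ℝ} (hq : 0 < q) :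
    Integrable (fun s => F s * kerJ δ q s) (volume.restrict (Ioi 0)) := by
  have h := (kerJ_main hδ (Real.sqrt_pos.2 hq)).1
  rw [Real.sq_sqrt hq.le] at h
  refine (h.const_mul M).mono' (hFm.aestronglyMeasurable.mul h.1) ?_
  refine (ae_restrict_iff' measurableSet_Ioi).2 (Eventually.of_forall fun s hs => ?_)
  have hs : (0:ℝ) < s := hs
  have hJ : 0 ≤ kerJ δ q s := by unfold kerJ; positivity
  rw [Real.norm_of_nonneg (mul_nonneg (hF0 s hs) hJ)]
  exact mul_le_mul_of_nonneg_right (hFM s hs) hJ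

lemma G_diff {δ : ℝ} (hδ : 0 < δ) {F : ℝ → ℝ} {M : ℝ}
    (hFm : AEMeasurable F (volume.restrict (Ioi 0)))
    (hF0 : ∀ t, 0 < t → 0 ≤ F t) (hFM : ∀ t, 0 < t → F t ≤ M) {q : ℝ} (hq : 0 < q) :
    DifferentiableAt ℝ (fun q => ∫ s in Ioi (0:ℝ), F s * kerJ δ q s) q := by
  have hJm : ∀ q, Measurable (kerJ δ q) := fun q => by unfold kerJ; fun_prop
  refine (hasDerivAt_integral_of_dominated_loc_of_deriv_le
    (F' := fun x s => F s * (-(s ^ (δ - 1)) / (x + (s ^ δ) ^ 2) ^ 2))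
    (bound := fun s => (q / 2)⁻¹ * (F s * kerJ δ (q / 2) s))
    (Ioi_mem_nhds (show q / 2 < q by linarith)) ?_ (G_int hδ hFm hF0 hFM hq) ?_ ?_ ?_ ?_).2.differentiableAt
  · exact Eventually.of_forall fun x => (hFm.mul (hJm x).aemeasurable).aestronglyMeasurable
  · refine (hFm.mul (Measurable.aemeasurable ?_)).aestronglyMeasurable
    fun_prop
  · refine (ae_restrict_iff' measurableSet_Ioi).2 (Eventually.of_forall fun s hs x hx => ?_)
    have hs : (0:ℝ) < s := hs
    have hx : q / 2 < x := hx
    have hq2 : 0 < q / 2 := by linarith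
    have hx0 : 0 < x := by linarith
    have hF := hF0 s hs
    have hb : (0:ℝ) < s ^ (δ - 1) := by positivity
    have hd : 0 ≤ (s ^ δ) ^ 2 := by positivity
    rw [norm_mul, norm_div, norm_neg, Real.norm_of_nonneg hF, Real.norm_of_nonneg hb.le,
      Real.norm_of_nonneg (by positivity)]
    unfold kerJ
    have : s ^ (δ - 1) / (x + (s ^ δ) ^ 2) ^ 2 ≤
        s ^ (δ - 1) / ((q / 2) * (q / 2 + (s ^ δ) ^ 2)) := by
      apply div_le_div_of_nonneg_left hb.le (by positivity)
      rw [sq (x + _)]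
      apply mul_le_mul <;> first | positivity | linarith
    calc F s * (s ^ (δ - 1) / (x + (s ^ δ) ^ 2) ^ 2)
        ≤ F s * (s ^ (δ - 1) / ((q / 2) * (q / 2 + (s ^ δ) ^ 2))) := by gcongr
      _ = _ := by field_simp
  · exact (G_int hδ hFm hF0 hFM (by linarith)).const_mul _
  · refine (ae_restrict_iff' measurableSet_Ioi).2 (Eventually.of_forall fun s hs x hx => ?_)
    have hs : (0:ℝ) < s := hs
    have hx : q / 2 < x := hx
    have hx0 : 0 < x := by linarith
    have hne : x + (s ^ δ) ^ 2 ≠ 0 := by positivity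
    apply HasDerivAt.const_mul
    unfold kerJ
    have := ((hasDerivAt_id x).add_const ((s ^ δ) ^ 2)).fun_inv hne
    have h2 := this.const_mul (s ^ (δ - 1))
    simp only [id, div_eq_mul_inv] at h2 ⊢
    refine h2.congr_deriv ?_
    ring

lemma G_anti {δ : ℝ} (hδ : 0 < δ) {F : ℝ → ℝ} {M : ℝ}
    (hFm : AEMeasurable F (volume.restrict (Ioi 0)))
    (hF0 : ∀ t, 0 < t → 0 ≤ F t) (hFM : ∀ t, 0 < t → F t ≤ M) {q r : ℝ} (hq : 0 < q)
    (hqr : q ≤ r) :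
    ∫ s in Ioi (0:ℝ), F s * kerJ δ r s ≤ ∫ s in Ioi (0:ℝ), F s * kerJ δ q s := by
  refine setIntegral_mono_on (G_int hδ hFm hF0 hFM (hq.trans_le hqr))
    (G_int hδ hFm hF0 hFM hq) measurableSet_Ioi fun s hs => ?_
  have hs : (0:ℝ) < s := hs
  have := hF0 s hs
  unfold kerJ
  gcongr

lemma G_mono {δ : ℝ} (hδ : 0 < δ) {F : ℝ → ℝ} {M : ℝ}
    (hFm : AEMeasurable F (volume.restrict (Ioi 0)))
    (hF0 : ∀ t, 0 < t → 0 ≤ F t) (hFM : ∀ t, 0 < t → F t ≤ M) {q r : ℝ} (hq : 0 < q)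
    (hqr : q ≤ r) :
    q * ∫ s in Ioi (0:ℝ), F s * kerJ δ q s ≤ r * ∫ s in Ioi (0:ℝ), F s * kerJ δ r s := by
  have hr := hq.trans_le hqr
  rw [← integral_const_mul, ← integral_const_mul]
  refine setIntegral_mono_on ((G_int hδ hFm hF0 hFM hq).const_mul _)
    ((G_int hδ hFm hF0 hFM hr).const_mul _) measurableSet_Ioi fun s hs => ?_
  have hs : (0:ℝ) < s := hs
  have h0 := hF0 s hs
  have hd : (0:ℝ) ≤ (s ^ δ) ^ 2 := by positivity
  have hb : (0:ℝ) < s ^ (δ - 1) := by positivity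
  unfold kerJ
  have : q / (q + (s ^ δ) ^ 2) ≤ r / (r + (s ^ δ) ^ 2) := by
    rw [div_le_div_iff₀ (by positivity) (by positivity)]
    nlinarith
  calc q * (F s * (s ^ (δ - 1) / (q + (s ^ δ) ^ 2)))
      = F s * s ^ (δ - 1) * (q / (q + (s ^ δ) ^ 2)) := by ring
    _ ≤ F s * s ^ (δ - 1) * (r / (r + (s ^ δ) ^ 2)) := by gcongr
    _ = _ := by ring

lemma G_lower {α δ : ℝ} (hα : 0 < α) (hδ : 0 < δ) {ψ : ℝ → ℝ}
    (h0 : ∀ t, 0 < t → 0 ≤ ψ t) (hm : MonotoneOn ψ (Ioi 0)) {t : ℝ} (ht : 0 < t)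
    (hint : Integrable (fun s => s ^ (-α) * ψ s * kerJ δ ((t ^ δ) ^ 2) s)
      (volume.restrict (Ioi 0))) :
    ψ t ≤ (4 * (2 ^ δ) ^ 2 * 2 ^ α) * (t ^ α * t ^ δ *
      ∫ s in Ioi (0:ℝ), s ^ (-α) * ψ s * kerJ δ ((t ^ δ) ^ 2) s) := by
  have hψ := h0 t ht
  have hsub : Ioc t (2*t) ⊆ Ioi 0 := fun x hx => lt_trans ht hx.1
  set b : ℝ := (2 * t) ^ (-α) * ψ t * (t ^ δ * (2 * t)⁻¹ / (2 * ((2 * t) ^ δ) ^ 2))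
  have h1 : t * b ≤ ∫ s in Ioi (0:ℝ), s ^ (-α) * ψ s * kerJ δ ((t ^ δ) ^ 2) s := by
    calc t * b = ∫ s in Ioc t (2*t), b := by
          simp [Measure.real, Real.volume_Ioc]
          left; rw [ENNReal.toReal_ofReal] <;> linarith
      _ ≤ ∫ s in Ioc t (2*t), s ^ (-α) * ψ s * kerJ δ ((t ^ δ) ^ 2) s := by
          refine setIntegral_mono_on (by simp) (IntegrableOn.mono_set hint hsub) measurableSet_Ioc
            fun s hs => ?_
          have hs0 : 0 < s := lt_trans ht hs.1
          have h2 := hm ht hs0 hs.1.le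
          have h3 : (2*t) ^ (-α) ≤ s ^ (-α) :=
            Real.rpow_le_rpow_of_nonpos hs0 hs.2 (by linarith)
          have h4 := h0 s hs0
          have h5 : t ^ δ ≤ s ^ δ := Real.rpow_le_rpow ht.le hs.1.le hδ.le
          have h6 : s ^ δ ≤ (2 * t) ^ δ := Real.rpow_le_rpow hs0.le hs.2 hδ.le
          have h7 : (2 * t)⁻¹ ≤ s⁻¹ := by have := hs.2; gcongr
          have h8 : (t ^ δ) ^ 2 + (s ^ δ) ^ 2 ≤ 2 * ((2 * t) ^ δ) ^ 2 := by
            have a1 : (t ^ δ) ^ 2 ≤ ((2 * t) ^ δ) ^ 2 := by gcongr; linarith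
            have a2 : (s ^ δ) ^ 2 ≤ ((2 * t) ^ δ) ^ 2 := by gcongr
            linarith
          have h9 : kerJ δ ((t ^ δ) ^ 2) s = s ^ δ * s⁻¹ / ((t ^ δ) ^ 2 + (s ^ δ) ^ 2) := by
            unfold kerJ; rw [Real.rpow_sub hs0, Real.rpow_one]; rfl
          rw [h9]
          simp only [b]
          gcongr
      _ ≤ _ := by
          refine setIntegral_mono_set hint ?_ hsub.eventuallyLE
          refine (ae_restrict_iff' measurableSet_Ioi).2 (Eventually.of_forall fun s hs => ?_)
          have hs : (0:ℝ) < s := hs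
          have := h0 s hs
          simp only [Pi.zero_apply, kerJ]; positivity
  calc ψ t = (4 * (2 ^ δ) ^ 2 * 2 ^ α) * (t ^ α * t ^ δ * (t * b)) := by
        simp only [b]
        rw [Real.mul_rpow (by norm_num) ht.le, Real.mul_rpow (by norm_num) ht.le,
          Real.rpow_neg (by norm_num), Real.rpow_neg ht.le]
        have : (0:ℝ) < t ^ α := by positivity
        have : (0:ℝ) < t ^ δ := by positivity
        have : (0:ℝ) < 2 ^ α := by positivity
        have : (0:ℝ) < 2 ^ δ := by positivity
        field_simp
        norm_num
    _ ≤ _ := by gcongr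

/-- majorization of a monotone function by a smooth one with controlled
growth (Lemma 2). -/
theorem stmt1 (α : ℝ) (hα : 0 < α) (δ : ℝ) (hδ : 0 < δ) :
    ∃ c : ℝ, 0 < c ∧
      ∀ θ : ℝ≥0∞, 1 ≤ θ →
      ∀ ψ : ℝ → ℝ, (∀ t, 0 < t → 0 ≤ ψ t) → MonotoneOn ψ (Set.Ioi 0) →
        calL θ (fun t => t ^ (-α) * ψ t) < ∞ →
        ∃ φ : ℝ → ℝ,
          ContinuousOn φ (Set.Ioi 0) ∧ DifferentiableOn ℝ φ (Set.Ioi 0) ∧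
          (∀ t, 0 < t → ψ t ≤ φ t) ∧
          AntitoneOn (fun t => φ t * t ^ (-α - δ)) (Set.Ioi 0) ∧
          MonotoneOn (fun t => φ t * t ^ (-α + δ)) (Set.Ioi 0) ∧
          calL θ (fun t => t ^ (-α) * φ t) ≤
            ENNReal.ofReal c * calL θ (fun t => t ^ (-α) * ψ t) := by
  set C : ℝ := 4 * (2 ^ δ) ^ 2 * 2 ^ α with hC
  have hC0 : 0 < C := by positivity
  refine ⟨C * (Real.pi / (2 * δ)), by positivity, ?_⟩
  intro θ hθ ψ h0 hm hfin
  obtain ⟨M, hM⟩ := bdd_F hα hθ h0 hm hfin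
  set F : ℝ → ℝ := fun s => s ^ (-α) * ψ s with hF
  have hFm : AEMeasurable F (volume.restrict (Ioi 0)) :=
    AEMeasurable.mul (by fun_prop) (aemeasurable_restrict_of_monotoneOn measurableSet_Ioi hm)
  have hF0 : ∀ t, 0 < t → 0 ≤ F t := fun t ht => mul_nonneg (by positivity) (h0 t ht)
  set G : ℝ → ℝ := fun q => ∫ s in Ioi (0:ℝ), F s * kerJ δ q s with hG
  have hdiff : DifferentiableOn ℝ (fun t => C * (t ^ α * t ^ δ * G ((t ^ δ) ^ 2))) (Ioi 0) := by
    intro t ht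
    have ht : (0:ℝ) < t := ht
    apply DifferentiableAt.differentiableWithinAt
    have a1 : ∀ β : ℝ, DifferentiableAt ℝ (fun t : ℝ => t ^ β) t :=
      fun β => Real.differentiableAt_rpow_const_of_ne β ht.ne'
    have a2 : DifferentiableAt ℝ (fun t : ℝ => G ((t ^ δ) ^ 2)) t :=
      DifferentiableAt.comp (g := G) t (G_diff hδ hFm hF0 hM (by positivity)) ((a1 δ).pow 2)
    exact (((a1 α).mul (a1 δ)).mul a2).const_mul C
  have hGnn : ∀ q, 0 < q → 0 ≤ G q := by
    intro q hq
    refine setIntegral_nonneg measurableSet_Ioi fun s hs => ?_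
    have hs : (0:ℝ) < s := hs
    have := hF0 s hs
    unfold kerJ; positivity
  refine ⟨fun t => C * (t ^ α * t ^ δ * G ((t ^ δ) ^ 2)), hdiff.continuousOn, hdiff,
    ?_, ?_, ?_, ?_⟩
  · intro t ht
    exact G_lower hα hδ h0 hm ht (G_int hδ hFm hF0 hM (by positivity))
  · have e : ∀ t : ℝ, 0 < t → C * (t ^ α * t ^ δ * G ((t ^ δ) ^ 2)) * t ^ (-α - δ) =
        C * G ((t ^ δ) ^ 2) := by
      intro t ht
      rw [Real.rpow_sub ht, Real.rpow_neg ht.le]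
      have : (0:ℝ) < t ^ α := by positivity
      have : (0:ℝ) < t ^ δ := by positivity
      field_simp
    intro t ht u hu htu
    have ht : (0:ℝ) < t := ht
    have hu : (0:ℝ) < u := hu
    simp only
    rw [e t ht, e u hu]
    apply mul_le_mul_of_nonneg_left _ hC0.le
    exact G_anti hδ hFm hF0 hM (by positivity) (by gcongr)
  · have e : ∀ t : ℝ, 0 < t → C * (t ^ α * t ^ δ * G ((t ^ δ) ^ 2)) * t ^ (-α + δ) =
        C * ((t ^ δ) ^ 2 * G ((t ^ δ) ^ 2)) := by
      intro t ht
      rw [Real.rpow_add ht, Real.rpow_neg ht.le]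
      have : (0:ℝ) < t ^ α := by positivity
      have : (0:ℝ) < t ^ δ := by positivity
      field_simp
    intro t ht u hu htu
    have ht : (0:ℝ) < t := ht
    have hu : (0:ℝ) < u := hu
    simp only
    rw [e t ht, e u hu]
    apply mul_le_mul_of_nonneg_left _ hC0.le
    exact G_mono hδ hFm hF0 hM (by positivity) (by gcongr)
  · have hfm' : AEMeasurable (fun s => ENNReal.ofReal C * ENNReal.ofReal |F s|) muLog := by
      have h1 : AEMeasurable F muLog := hFm.mono_ac (withDensity_absolutelyContinuous _ _)
      exact (measurable_norm.comp_aemeasurable h1).ennreal_ofReal.const_mul _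
    have hle : calL θ (fun t => t ^ (-α) * (C * (t ^ α * t ^ δ * G ((t ^ δ) ^ 2)))) ≤
        calLE θ (fun t => ∫⁻ s, (ENNReal.ofReal C * ENNReal.ofReal |F s|) *
          ENNReal.ofReal (kerK δ t s) ∂muLog) := by
      apply calLE_mono
      intro t ht
      have hq : 0 < (t ^ δ) ^ 2 := by positivity
      have hg := hGnn _ hq
      have e1 : |t ^ (-α) * (C * (t ^ α * t ^ δ * G ((t ^ δ) ^ 2)))| =
          ∫ s in Ioi (0:ℝ), (C * t ^ δ) * (F s * kerJ δ ((t ^ δ) ^ 2) s) := by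
        rw [abs_of_nonneg (by positivity), integral_const_mul, Real.rpow_neg ht.le]
        have : (0:ℝ) < t ^ α := by positivity
        field_simp
        rfl
      rw [e1, ofReal_integral_eq_lintegral_ofReal ((G_int hδ hFm hF0 hM hq).const_mul _),
        lint_muLog]
      · apply le_of_eq
        refine setLIntegral_congr_fun measurableSet_Ioi fun s hs => ?_
        have hs : (0:ℝ) < s := hs
        have hFs := hF0 s hs
        rw [abs_of_nonneg hFs, ← ENNReal.ofReal_mul hC0.le, ← ENNReal.ofReal_mul (by positivity),
          ← ENNReal.ofReal_mul (by positivity)]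
        congr 1
        linear_combination (-(C * F s)) * kerK_eq (δ := δ) (t := t) hs
      · refine (ae_restrict_iff' measurableSet_Ioi).2 (Eventually.of_forall fun s hs => ?_)
        have hs : (0:ℝ) < s := hs
        have := hF0 s hs
        simp only [Pi.zero_apply, kerJ]; positivity
    refine hle.trans ?_
    calc _ ≤ calLE θ (fun t => ∫⁻ s, (ENNReal.ofReal C * ENNReal.ofReal |F s|) *
          ENNReal.ofReal (kerK δ t s) ∂muLog) := le_rfl
      _ ≤ ENNReal.ofReal (Real.pi / (2 * δ)) *
          calLE θ (fun s => ENNReal.ofReal C * ENNReal.ofReal |F s|) := schur_final hδ hfm' hθ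
      _ = ENNReal.ofReal (Real.pi / (2 * δ)) * (ENNReal.ofReal C *
          calLE θ (fun s => ENNReal.ofReal |F s|)) := by
        congr 1
        unfold calLE
        split_ifs with h
        · exact ENNReal.essSup_const_mul
        · have hp : 1 ≤ θ.toReal := by simpa using ENNReal.toReal_mono h hθ
          have hp0 : 0 < θ.toReal := by linarith
          simp_rw [ENNReal.mul_rpow_of_nonneg _ _ hp0.le]
          rw [lintegral_const_mul' _ _ (by simp [hp0.le]),
            ENNReal.mul_rpow_of_nonneg _ _ (by positivity), ← ENNReal.rpow_mul]
          simp [hp0.ne']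
      _ = _ := by
        rw [ENNReal.ofReal_mul hC0.le]
        unfold calL
        ring

end
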